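/- Let I : C → D be a fully faithful functor between small categories and φ : Cᵒᵖ → Set a presheaf. Then the category of elements of φ is sifted if and only if the category of elements of the (pointwise) left Kan extension of φ along Iᵒᵖ : Cᵒᵖ → Dᵒᵖ is sifted. -/

import Mathlib

open CategoryTheory CategoryTheory.Limits

section

universe w v₁ v₂ u₁ u₂

variable {A : Type u₁} {B : Type u₂} [Category.{v₁} A] [Category.{v₂} B]

/-- Two elements of a diagram of types with the same image in a colimit are related by the
equivalence relation generated by the transition maps. -/
lemma eqvGen_colimitTypeRel_of_isColimit {F : A ⥤ Type w} {c : Cocone F} (hc : IsColimit c)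
    {j j' : A} {x : F.obj j} {y : F.obj j'} (h : c.ι.app j x = c.ι.app j' y) :
    Relation.EqvGen F.ColimitTypeRel ⟨j, x⟩ ⟨j', y⟩ :=
  (F.ιColimitType_eq_iff x y).1
    (((Types.isColimit_iff_coconeTypesIsColimit c).1 ⟨hc⟩).bijective.1 h)

/-- A natural transformation `φ ⟶ F ⋙ ψ` induces a functor between categories of elements. -/
def elementsMapOver (F : A ⥤ B) {φ : A ⥤ Type w} {ψ : B ⥤ Type w} (α : φ ⟶ F ⋙ ψ) :
    φ.Elements ⥤ ψ.Elements where
  obj p := ⟨F.obj p.1, α.app p.1 p.2⟩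
  map {p q} f := ⟨F.map f.1, by
    have h := NatTrans.naturality_apply α f.1 p.2
    rw [f.2] at h
    exact h.symm⟩

variable {F : A ⥤ B} {φ : A ⥤ Type w} {ψ : B ⥤ Type w} (α : φ ⟶ F ⋙ ψ)

instance [F.Faithful] : (elementsMapOver F α).Faithful where
  map_injective h := Subtype.ext (F.map_injective (congrArg Subtype.val h))

/-- If `F` is full and the components of `α` are injective, then the induced functor between
categories of elements is full. -/
lemma elementsMapOver_full [F.Full] (hα : ∀ a, Function.Injective (α.app a)) :
    (elementsMapOver F α).Full where
  map_surjective {p q} f := by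
    obtain ⟨g, hg⟩ := F.map_surjective f.1
    refine ⟨⟨g, hα _ ?_⟩, Subtype.ext hg⟩
    have h := NatTrans.naturality_apply α g p.2
    rw [h]
    refine Eq.trans ?_ f.2
    rw [← hg]
    rfl

/-- The functor induced on categories of elements by the unit of a pointwise left Kan extension
is initial. -/
lemma elementsMapOver_initial
    (h : (Functor.LeftExtension.mk ψ α).IsPointwiseLeftKanExtension) :
    (elementsMapOver F α).Initial where
  out := by
    rintro ⟨b, y⟩
    let G : CostructuredArrow F b ⥤ Type w := CostructuredArrow.proj F b ⋙ φ
    let mk (s : Σ g, G.obj g) (hs : ψ.map s.1.hom (α.app _ s.2) = y) :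
        CostructuredArrow (elementsMapOver F α) (ψ.elementsMk b y) :=
      CostructuredArrow.mk (Y := φ.elementsMk s.1.left s.2)
        (show (elementsMapOver F α).obj _ ⟶ _ from ⟨s.1.hom, hs⟩)
    have zigzag {s t : Σ g, G.obj g} (hst : Relation.EqvGen G.ColimitTypeRel s t) :
        ψ.map s.1.hom (α.app _ s.2) = ψ.map t.1.hom (α.app _ t.2) ∧
          ∀ hs ht, Zigzag (mk s hs) (mk t ht) := by
      induction hst with
      | rel s t r =>
        obtain ⟨f, hf⟩ := r
        refine ⟨?_, fun hs ht ↦ Zigzag.of_hom (CostructuredArrow.homMk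
          (show φ.elementsMk s.1.left s.2 ⟶ φ.elementsMk t.1.left t.2 from ⟨f.left, hf.symm⟩)
          (Subtype.ext (CostructuredArrow.w f)))⟩
        rw [hf]
        exact (ConcreteCategory.congr_hom
          (((Functor.LeftExtension.mk ψ α).coconeAt b).w f) s.2).symm
      | refl s => exact ⟨rfl, fun _ _ ↦ Zigzag.refl _⟩
      | symm s t _ ih => exact ⟨ih.1.symm, fun hs ht ↦ (ih.2 ht hs).symm⟩
      | trans s t u _ _ ih₁ ih₂ =>
        exact ⟨ih₁.1.trans ih₂.1, fun hs hu ↦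
          (ih₁.2 hs (ih₁.1.symm.trans hs)).trans (ih₂.2 (ih₁.1.symm.trans hs) hu)⟩
    have : Nonempty (CostructuredArrow (elementsMapOver F α) (ψ.elementsMk b y)) := by
      obtain ⟨g, x, hx⟩ := Types.jointly_surjective_of_isColimit (h b) y
      exact ⟨mk ⟨g, x⟩ hx⟩
    refine zigzag_isConnected (J := CostructuredArrow (elementsMapOver F α) (ψ.elementsMk b y))
      fun p q ↦ ?_
    exact (zigzag (s := ⟨CostructuredArrow.mk p.hom.1, p.left.2⟩)
      (t := ⟨CostructuredArrow.mk q.hom.1, q.left.2⟩)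
      (eqvGen_colimitTypeRel_of_isColimit (h b) (p.hom.2.trans q.hom.2.symm))).2 p.hom.2 q.hom.2

/-- Along a fully faithful final functor, siftedness can be transferred in both directions. -/
lemma isSifted_iff_of_final_of_fullyFaithful (K : A ⥤ B) [K.Final] [K.Full] [K.Faithful] :
    IsSifted A ↔ IsSifted B := by
  refine ⟨fun _ ↦ IsSifted.of_final_functor_from_sifted K, fun hB ↦ ?_⟩
  have : (Functor.diag A ⋙ K.prod K).Final :=
    Functor.final_of_natIso (F := K ⋙ Functor.diag B) (Iso.refl _)
  have : (K.prod K).Full := ⟨fun f ↦ ⟨⟨K.preimage f.1, K.preimage f.2⟩, by ext <;> simp⟩⟩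
  have : (K.prod K).Faithful := ⟨fun h ↦ Prod.ext
    (K.map_injective (congrArg Prod.fst h)) (K.map_injective (congrArg Prod.snd h))⟩
  have : (Functor.diag A).Final := Functor.final_of_comp_full_faithful _ (K.prod K)
  have : Nonempty A := by
    obtain ⟨b⟩ := hB.nonempty
    obtain ⟨f⟩ := (Functor.Final.out (F := K) b).is_nonempty
    exact ⟨f.right⟩
  exact {}

/-- Siftedness is invariant under equivalence of categories. -/
lemma isSifted_iff_of_equivalence (e : A ≌ B) : IsSifted A ↔ IsSifted B :=
  isSifted_iff_of_final_of_fullyFaithful e.functor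

end

/-- For a fully faithful functor `I : C ⥤ D` between small categories and a
presheaf `φ` on `C` with pointwise left Kan extension `ψ` along `Iᵒᵖ`, the
category of elements of `φ` is sifted iff the category of elements of `ψ` is
sifted. -/
theorem elements_sifted_iff_elements_lan_sifted
    {C D : Type v} [SmallCategory C] [SmallCategory D]
    (I : C ⥤ D) (hI : I.FullyFaithful)
    (φ : Cᵒᵖ ⥤ Type v) (ψ : Dᵒᵖ ⥤ Type v) (α : φ ⟶ I.op ⋙ ψ)
    (hlan : Nonempty ((Functor.LeftExtension.mk ψ α).IsPointwiseLeftKanExtension)) :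
    IsSifted (CostructuredArrow yoneda φ) ↔ IsSifted (CostructuredArrow yoneda ψ) := by
  have := hI.full
  have := hI.faithful
  obtain ⟨h⟩ := hlan
  have hα (c : Cᵒᵖ) : Function.Injective (α.app c) := by
    have : IsIso (α.app c) := (h (I.op.obj c)).isIso_hom_app
    exact ((isIso_iff_bijective _).1 this).1
  have := elementsMapOver_initial α h
  have := elementsMapOver_full α hα
  rw [← isSifted_iff_of_equivalence (CategoryOfElements.costructuredArrowYonedaEquivalence φ),
    ← isSifted_iff_of_equivalence (CategoryOfElements.costructuredArrowYonedaEquivalence ψ)]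
  exact isSifted_iff_of_final_of_fullyFaithful (elementsMapOver I.op α).op
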